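/- For each K ≥ 3, let F = M_{−1,K} be the harmonic mean combining function. Then the limit L_K := lim_{δ↓0} b_F(δ)/a_F(δ) exists, equals c_F(ε)/a_F(ε) for every ε ∈ (0,1) (this ratio not depending on ε), and satisfies L_K/log K → 1 as K → ∞. -/

import Mathlib

open MeasureTheory ProbabilityTheory Real Set Filter

/-- The uniform probability measure on `[0,1]` (Lebesgue measure restricted to `[0,1]`). -/
noncomputable def unif01 : MeasureTheory.Measure ℝ :=
  MeasureTheory.volume.restrict (Set.Icc (0:ℝ) 1)

instance : MeasureTheory.IsProbabilityMeasure unif01 := by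
  constructor
  simp [unif01, Real.volume_Icc]

/-- `U` is uniformly distributed on `[0,1]` under `P`. -/
def IsUnif {Ω : Type*} [MeasurableSpace Ω] (P : MeasureTheory.Measure Ω) (U : Ω → ℝ) : Prop :=
  Measurable U ∧ MeasureTheory.Measure.map U P = unif01

/-- Left `ε`-quantile of a random variable `X` under `P`:
`q_ε(X) = inf {x : ε ≤ P(X ≤ x)}`. -/
noncomputable def lQuantile {Ω : Type*} [MeasurableSpace Ω] (P : MeasureTheory.Measure Ω)
    (X : Ω → ℝ) (ε : ℝ) : ℝ :=
  sInf {x : ℝ | ε ≤ (P {ω | X ω ≤ x}).toReal}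

/-- The measure `P` is atomless: every non-null measurable set has a measurable subset of
different, nonzero measure. -/
def Atomless {Ω : Type*} [MeasurableSpace Ω] (P : MeasureTheory.Measure Ω) : Prop :=
  ∀ A, MeasurableSet A → P A ≠ 0 →
    ∃ B, B ⊆ A ∧ MeasurableSet B ∧ P B ≠ 0 ∧ P B ≠ P A

/-- VAD threshold: infimum of left `ε`-quantiles of `F(U_1,…,U_K)` over all
uniformly distributed `U_1,…,U_K` on `[0,1]` with arbitrary joint dependence. -/
noncomputable def VAD {Ω : Type*} [MeasurableSpace Ω] (P : MeasureTheory.Measure Ω) (K : ℕ)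
    (F : (Fin K → ℝ) → ℝ) (ε : ℝ) : ℝ :=
  sInf {y : ℝ | ∃ U : Fin K → Ω → ℝ, (∀ i, IsUnif P (U i)) ∧
    y = lQuantile P (fun ω => F (fun i => U i ω)) ε}

/-- VI threshold: left `ε`-quantile of `F(V_1,…,V_K)` for independent uniforms,
realized via the product measure. -/
noncomputable def VI (K : ℕ) (F : (Fin K → ℝ) → ℝ) (ε : ℝ) : ℝ :=
  lQuantile (MeasureTheory.Measure.pi fun _ : Fin K => unif01) F ε

/-- VC threshold: left `ε`-quantile of `F(U,…,U)` for a single uniform `U`. -/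
noncomputable def VC (K : ℕ) (F : (Fin K → ℝ) → ℝ) (ε : ℝ) : ℝ :=
  lQuantile unif01 (fun u => F (fun _ => u)) ε

/-- harmonic mean combining function `M_{-1,K}`. -/
noncomputable def Mharm (K : ℕ) (p : Fin K → ℝ) : ℝ :=
  (K : ℝ) / (∑ i, (p i)⁻¹)

lemma unif01_Iic (x : ℝ) : unif01 (Iic x) = ENNReal.ofReal (min 1 x) := by
  have : Iic x ∩ Icc (0:ℝ) 1 = Icc 0 (min 1 x) := by
    ext t
    simp only [mem_inter_iff, mem_Iic, mem_Icc, le_min_iff]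
    tauto
  rw [unif01, Measure.restrict_apply measurableSet_Iic, this, Real.volume_Icc, sub_zero]

instance : NullSingletonClass unif01 := by
  unfold unif01; infer_instance

lemma continuous_cdf (μ : Measure ℝ) [IsProbabilityMeasure μ] [NullSingletonClass μ] :
    Continuous (cdf μ) := by
  rw [continuous_iff_continuousAt]
  intro a
  have h := (cdf μ).measure_singleton a
  rw [measure_cdf, measure_singleton] at h
  rw [(monotone_cdf μ).continuousAt_iff_leftLim_eq_rightLim, (cdf μ).rightLim_eq]
  exact le_antisymm ((monotone_cdf μ).leftLim_le le_rfl)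
    (by simpa using ENNReal.ofReal_eq_zero.1 h.symm)

/-- Probability integral transform. -/
lemma map_cdf (μ : Measure ℝ) [IsProbabilityMeasure μ] [NullSingletonClass μ] :
    μ.map (cdf μ) = unif01 := by
  have hc := continuous_cdf μ
  have ivt : ∀ y ∈ Ioo (0:ℝ) 1, ∃ t, cdf μ t = y := by
    intro y hy
    obtain ⟨a, ha⟩ := ((tendsto_cdf_atBot μ).eventually (eventually_lt_nhds hy.1)).exists
    obtain ⟨b, hb⟩ := ((tendsto_cdf_atTop μ).eventually (eventually_gt_nhds hy.2)).exists
    exact mem_range_of_exists_le_of_exists_ge hc ⟨a, ha.le⟩ ⟨b, hb.le⟩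
  have hle : ∀ y, ∀ y' ∈ Ioo (0:ℝ) 1, y < y' →
      μ (cdf μ ⁻¹' Iic y) ≤ ENNReal.ofReal y' := by
    intro y y' hy' hyy
    obtain ⟨t, ht⟩ := ivt y' hy'
    rw [← ht, ofReal_cdf]
    refine measure_mono fun s hs => ?_
    by_contra hst
    have := monotone_cdf μ (not_le.1 hst).le
    simp only [mem_preimage, mem_Iic] at hs
    linarith
  have : IsProbabilityMeasure (μ.map (cdf μ)) := Measure.isProbabilityMeasure_map
    hc.measurable.aemeasurable
  refine Measure.ext_of_Iic _ _ fun y => ?_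
  rw [unif01_Iic, Measure.map_apply hc.measurable measurableSet_Iic]
  rcases le_or_gt 1 y with h1 | h1
  · rw [min_eq_left h1, ENNReal.ofReal_one]
    convert measure_univ (μ := μ)
    exact eq_univ_of_forall fun s => (cdf_le_one μ s).trans h1
  rw [min_eq_right h1.le]
  apply le_antisymm
  · rcases lt_or_ge y 0 with h0 | h0
    · refine le_of_eq_of_le ?_ zero_le
      convert measure_empty (μ := μ)
      exact eq_empty_of_forall_notMem fun s hs => absurd (cdf_nonneg μ s) (not_le.2 (lt_of_le_of_lt hs h0))
    · have : Tendsto (fun y' => ENNReal.ofReal y') (nhdsWithin y (Ioi y))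
          (nhds (ENNReal.ofReal y)) :=
        (ENNReal.continuous_ofReal.tendsto y).mono_left nhdsWithin_le_nhds
      refine ge_of_tendsto this ?_
      filter_upwards [Ioo_mem_nhdsGT h1] with y' hy'
      exact hle y y' ⟨h0.trans_lt hy'.1, hy'.2⟩ hy'.1
  · rcases le_or_gt y 0 with h0 | h0
    · simp [ENNReal.ofReal_of_nonpos h0]
    obtain ⟨t, ht⟩ := ivt y ⟨h0, h1⟩
    rw [← ht, ofReal_cdf]
    exact measure_mono fun s hs => monotone_cdf μ hs

section Realize

variable {Ω : Type*} [MeasurableSpace Ω] {P : Measure Ω} [IsProbabilityMeasure P]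

/-- An atomless probability space carries a real random variable with no atoms. -/
lemma Atomless.exists_map_nullSingletonClass (hP : Atomless P) :
    ∃ f : Ω → ℝ, Measurable f ∧ NullSingletonClass (P.map f) := by
  let φ : (Ω → ℝ) → ENNReal := fun f => (P.prod P) {x | f x.1 = f x.2}
  let S : Set ENNReal := φ '' {f | Measurable f}
  have hne : S.Nonempty := ⟨_, fun _ => 0, measurable_const, rfl⟩
  obtain ⟨u, -, hu, huS⟩ := exists_seq_tendsto_sInf hne (OrderBot.bddBelow S)
  choose f hf hfu using huS
  let e := embeddingReal (ℕ → ℝ)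
  have he : MeasurableEmbedding e := measurableEmbedding_embeddingReal _
  let g : Ω → ℝ := fun ω => e fun n => f n ω
  have hg : Measurable g := he.measurable.comp (measurable_pi_lambda _ hf)
  have hgm : φ g ≤ sInf S := by
    refine ge_of_tendsto hu (Eventually.of_forall fun n => ?_)
    rw [← hfu n]
    refine measure_mono fun x hx => ?_
    exact congrFun (he.injective hx) n
  refine ⟨g, hg, ⟨fun w => ?_⟩⟩
  by_contra hw
  rw [Measure.map_apply hg (measurableSet_singleton w)] at hw
  obtain ⟨B, hBA, hB, hB0, hBne⟩ := hP _ (hg (measurableSet_singleton w)) hw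
  have hD : P (g ⁻¹' {w} \ B) ≠ 0 := by
    intro h
    exact hBne (measure_eq_measure_of_null_sdiff hBA h)
  classical
  let e2 := embeddingReal (ℝ × ℝ)
  have he2 : MeasurableEmbedding e2 := measurableEmbedding_embeddingReal _
  let k : Ω → ℝ := fun ω => e2 (g ω, B.indicator (fun _ => 1) ω)
  have hk : Measurable k := he2.measurable.comp
    (hg.prodMk (measurable_const.indicator hB))
  have hkφ : sInf S ≤ φ k := sInf_le ⟨k, hk, rfl⟩
  have hsub : {x : Ω × Ω | k x.1 = k x.2} ⊆
      {x | g x.1 = g x.2} \ (B ×ˢ (g ⁻¹' {w} \ B)) := by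
    intro x hx
    have := he2.injective hx
    simp only [Prod.mk.injEq] at this
    refine ⟨this.1, fun hx' => ?_⟩
    have h2 := this.2
    rw [indicator_of_mem hx'.1, indicator_of_notMem hx'.2.2] at h2
    exact one_ne_zero h2
  have hsub2 : (B ×ˢ (g ⁻¹' {w} \ B)) ⊆ {x : Ω × Ω | g x.1 = g x.2} := by
    rintro x ⟨h1, h2⟩
    have := hBA h1
    have h3 := h2.1
    simp only [mem_preimage, mem_singleton_iff] at this h3
    simp [this, h3]
  have hmeas : MeasurableSet (B ×ˢ (g ⁻¹' {w} \ B)) :=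
    hB.prod ((hg (measurableSet_singleton w)).diff hB)
  have hpos : (P.prod P) (B ×ˢ (g ⁻¹' {w} \ B)) ≠ 0 := by
    rw [Measure.prod_prod]
    exact mul_ne_zero hB0 hD
  have hlt : φ k < φ g := by
    calc φ k ≤ (P.prod P) ({x | g x.1 = g x.2} \ (B ×ˢ (g ⁻¹' {w} \ B))) := measure_mono hsub
      _ = φ g - (P.prod P) (B ×ˢ (g ⁻¹' {w} \ B)) :=
        measure_sdiff hsub2 hmeas.nullMeasurableSet (measure_ne_top _ _)
      _ < φ g := ENNReal.sub_lt_self (measure_ne_top _ _)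
        (fun h => hpos (le_antisymm (h ▸ measure_mono hsub2) zero_le)) hpos
  exact absurd (hkφ.trans_lt hlt) (not_lt.2 hgm)

/-- Every law on a nonempty standard Borel space is realized on an atomless space. -/
lemma Atomless.exists_map_eq (hP : Atomless P) {Y : Type*} [MeasurableSpace Y]
    [StandardBorelSpace Y] [Nonempty Y] (ν : Measure Y) [IsProbabilityMeasure ν] :
    ∃ X : Ω → Y, Measurable X ∧ P.map X = ν := by
  obtain ⟨f, hf, hna⟩ := hP.exists_map_nullSingletonClass
  have : IsProbabilityMeasure (P.map f) := Measure.isProbabilityMeasure_map hf.aemeasurable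
  obtain ⟨g, hg, hgν⟩ := ν.exists_measurable_map_eq
  have hc := (continuous_cdf (P.map f)).measurable
  let W : Ω → unitInterval := fun ω =>
    ⟨cdf (P.map f) (f ω), cdf_nonneg _ _, cdf_le_one _ _⟩
  have hW : Measurable W := (hc.comp hf).subtype_mk
  have hWv : P.map W = volume := by
    have h1 : (P.map W).map ((↑) : unitInterval → ℝ) =
        (volume : Measure unitInterval).map (↑) := by
      rw [unitInterval.measurePreserving_coe.map_eq, Measure.map_map measurable_subtype_coe hW]
      have := map_cdf (P.map f)
      rw [Measure.map_map hc hf] at this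
      exact this
    have hemb := MeasurableEmbedding.subtype_coe (measurableSet_Icc (a := (0:ℝ)) (b := 1))
    rw [← hemb.comap_map (P.map W), ← hemb.comap_map (volume : Measure unitInterval), h1]
  exact ⟨g ∘ W, hg.comp hW, by rw [← Measure.map_map hg hW, hWv, hgν]⟩

end Realize

section Quantile

variable {Ω : Type*} [MeasurableSpace Ω] {P : Measure Ω} [IsProbabilityMeasure P]

/-- The infimum defining the left quantile is attained. -/
lemma le_measureReal_le_lQuantile {X : Ω → ℝ} (hX : Measurable X) {ε : ℝ}
    (hne : {x : ℝ | ε ≤ (P {ω | X ω ≤ x}).toReal}.Nonempty) :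
    ε ≤ (P {ω | X ω ≤ lQuantile P X ε}).toReal := by
  have : IsProbabilityMeasure (P.map X) := Measure.isProbabilityMeasure_map hX.aemeasurable
  have hcdf : ∀ x, (P {ω | X ω ≤ x}).toReal = cdf (P.map X) x := by
    intro x
    rw [cdf_eq_real, Measure.real, Measure.map_apply hX measurableSet_Iic]
    rfl
  simp only [hcdf] at hne ⊢
  have hq : lQuantile P X ε = sInf {x | ε ≤ cdf (P.map X) x} := by simp only [lQuantile, hcdf]
  have hlim : Tendsto (cdf (P.map X)) (nhdsWithin (lQuantile P X ε) (Ioi (lQuantile P X ε)))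
      (nhds (cdf (P.map X) (lQuantile P X ε))) :=
    ((cdf (P.map X)).right_continuous _).mono Ioi_subset_Ici_self
  refine ge_of_tendsto hlim ?_
  filter_upwards [self_mem_nhdsWithin] with y hy
  rw [mem_Ioi, hq] at hy
  obtain ⟨x, hx, hxy⟩ := exists_lt_of_csInf_lt hne hy
  exact le_trans hx (monotone_cdf _ hxy.le)

end Quantile

lemma ae_unif01_mem_Ioc : ∀ᵐ u ∂unif01, u ∈ Ioc (0:ℝ) 1 := by
  have h1 : ∀ᵐ u ∂unif01, u ∈ Icc (0:ℝ) 1 := ae_restrict_mem measurableSet_Icc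
  have h2 : ∀ᵐ u ∂unif01, u ≠ 0 := measure_eq_zero_iff_ae_notMem.1 (measure_singleton (0:ℝ))
  filter_upwards [h1, h2] with u hu hu0
  exact ⟨lt_of_le_of_ne hu.1 (Ne.symm hu0), hu.2⟩

lemma measurable_Mharm (K : ℕ) : Measurable (Mharm K) := by
  unfold Mharm
  fun_prop

lemma Mharm_smul (K : ℕ) (c : ℝ) (p : Fin K → ℝ) : Mharm K (c • p) = c * Mharm K p := by
  simp only [Mharm, Pi.smul_apply, smul_eq_mul, mul_inv, ← Finset.mul_sum]
  simp only [div_eq_mul_inv, mul_inv, inv_inv]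
  ring

lemma Mharm_const {K : ℕ} (hK : 0 < K) (u : ℝ) : Mharm K (fun _ => u) = u := by
  have : (K : ℝ) ≠ 0 := by positivity
  simp only [Mharm, Finset.sum_const, Finset.card_univ, Fintype.card_fin, nsmul_eq_mul,
    div_eq_mul_inv, mul_inv, inv_inv]
  rw [← mul_assoc, mul_inv_cancel₀ this, one_mul]

lemma sum_inv_pos {K : ℕ} (hK : 0 < K) {p : Fin K → ℝ} (hp : ∀ i, 0 < p i) :
    0 < ∑ i, (p i)⁻¹ :=
  Finset.sum_pos (fun i _ => inv_pos.2 (hp i)) ⟨⟨0, hK⟩, Finset.mem_univ _⟩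

lemma Mharm_pos {K : ℕ} (hK : 0 < K) {p : Fin K → ℝ} (hp : ∀ i, 0 < p i) : 0 < Mharm K p :=
  div_pos (by exact_mod_cast hK) (sum_inv_pos hK hp)

lemma Mharm_mono {K : ℕ} (hK : 0 < K) {p q : Fin K → ℝ} (hp : ∀ i, 0 < p i)
    (hpq : ∀ i, p i ≤ q i) : Mharm K p ≤ Mharm K q := by
  refine div_le_div_of_nonneg_left (by positivity)
    (sum_inv_pos hK fun i => (hp i).trans_le (hpq i)) ?_
  exact Finset.sum_le_sum fun i _ => inv_anti₀ (hp i) (hpq i)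

lemma Mharm_le_one {K : ℕ} (hK : 0 < K) {p : Fin K → ℝ} (hp : ∀ i, 0 < p i)
    (hp1 : ∀ i, p i ≤ 1) : Mharm K p ≤ 1 :=
  (Mharm_mono hK hp hp1).trans_eq (Mharm_const hK 1)

/-- Joint laws of `K` random variables uniformly distributed on `[0,1]`. -/
structure IsUnifCoupling {K : ℕ} (ν : Measure (Fin K → ℝ)) : Prop where
  isProbabilityMeasure : IsProbabilityMeasure ν
  map_eval : ∀ i, ν.map (fun v => v i) = unif01

namespace IsUnifCoupling

variable {K : ℕ} {ν : Measure (Fin K → ℝ)}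

lemma measure_preimage_eval (h : IsUnifCoupling ν) (i : Fin K) {s : Set ℝ}
    (hs : MeasurableSet s) : ν {v | v i ∈ s} = unif01 s := by
  rw [← h.map_eval i, Measure.map_apply (measurable_pi_apply i) hs]
  rfl

lemma ae_mem_Ioc (h : IsUnifCoupling ν) : ∀ᵐ v ∂ν, ∀ i, v i ∈ Ioc (0:ℝ) 1 := by
  rw [ae_all_iff]
  intro i
  have := ae_unif01_mem_Ioc
  rw [← h.map_eval i] at this
  exact ae_of_ae_map (measurable_pi_apply i).aemeasurable this

lemma measure_Mharm_le_one (hK : 0 < K) (h : IsUnifCoupling ν) : ν {v | Mharm K v ≤ 1} = 1 := by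
  have := h.isProbabilityMeasure
  have : ∀ᵐ v ∂ν, Mharm K v ≤ 1 := by
    filter_upwards [h.ae_mem_Ioc] with v hv
    exact Mharm_le_one hK (fun i => (hv i).1) fun i => (hv i).2
  exact (prob_compl_eq_zero_iff (measurableSet_le (measurable_Mharm K) measurable_const)).1 this

lemma pos_of_measure_ne_zero (hK : 0 < K) (h : IsUnifCoupling ν) {x : ℝ}
    (hx : ν {v | Mharm K v ≤ x} ≠ 0) : 0 < x := by
  by_contra hx0
  refine hx (measure_eq_zero_iff_ae_notMem.2 ?_)
  filter_upwards [h.ae_mem_Ioc] with v hv hvx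
  exact hx0 ((Mharm_pos hK fun i => (hv i).1).trans_le hvx)

lemma nonempty_quantile (hK : 0 < K) (h : IsUnifCoupling ν) {ε : ℝ} (hε : ε ≤ 1) :
    {x : ℝ | ε ≤ (ν {v | Mharm K v ≤ x}).toReal}.Nonempty :=
  ⟨1, by simpa [h.measure_Mharm_le_one hK] using hε⟩

lemma pos_of_le (hK : 0 < K) (h : IsUnifCoupling ν) {ε x : ℝ} (hε : 0 < ε)
    (hx : ε ≤ (ν {v | Mharm K v ≤ x}).toReal) : 0 < x :=
  h.pos_of_measure_ne_zero hK fun h0 => by simp [h0] at hx; linarith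

lemma lQuantile_le (hK : 0 < K) (h : IsUnifCoupling ν) {ε x : ℝ} (hε : 0 < ε)
    (hx : ε ≤ (ν {v | Mharm K v ≤ x}).toReal) : lQuantile ν (Mharm K) ε ≤ x :=
  csInf_le ⟨0, fun _ hy => (h.pos_of_le hK hε hy).le⟩ hx

end IsUnifCoupling

/-- The levels `x` such that `P(F(U₁,…,U_K) ≤ x) ≥ ε` for some coupling of uniforms, `F` being
the harmonic mean. -/
def feasibleLevels (K : ℕ) (ε : ℝ) : Set ℝ :=
  {x | ∃ ν : Measure (Fin K → ℝ), IsUnifCoupling ν ∧ ε ≤ (ν {v | Mharm K v ≤ x}).toReal}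

lemma VAD_eq_sInf_feasibleLevels {Ω : Type*} [MeasurableSpace Ω] {P : Measure Ω}
    [IsProbabilityMeasure P] (hP : Atomless P) {K : ℕ} (hK : 0 < K) {ε : ℝ} (hε : 0 < ε)
    (hε1 : ε ≤ 1) : VAD P K (Mharm K) ε = sInf (feasibleLevels K ε) := by
  have key : {y : ℝ | ∃ U : Fin K → Ω → ℝ, (∀ i, IsUnif P (U i)) ∧
      y = lQuantile P (fun ω => Mharm K (fun i => U i ω)) ε} =
      {y | ∃ ν : Measure (Fin K → ℝ), IsUnifCoupling ν ∧ y = lQuantile ν (Mharm K) ε} := by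
    ext y
    constructor
    · rintro ⟨U, hU, rfl⟩
      have hm : Measurable fun ω i => U i ω := measurable_pi_lambda _ fun i => (hU i).1
      refine ⟨P.map fun ω i => U i ω, ⟨Measure.isProbabilityMeasure_map hm.aemeasurable,
        fun i => ?_⟩, ?_⟩
      · rw [Measure.map_map (measurable_pi_apply i) hm]
        exact (hU i).2
      · simp only [lQuantile]
        congr! 5 with x
        rw [Measure.map_apply hm (measurableSet_le (measurable_Mharm K) measurable_const)]
        rfl
    · rintro ⟨ν, hν, rfl⟩
      have := hν.isProbabilityMeasure
      obtain ⟨X, hX, rfl⟩ := hP.exists_map_eq ν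
      refine ⟨fun i ω => X ω i, fun i => ⟨(measurable_pi_apply i).comp hX, ?_⟩, ?_⟩
      · rw [← hν.map_eval i, Measure.map_map (measurable_pi_apply i) hX]
        rfl
      · simp only [lQuantile]
        congr! 5 with x
        rw [Measure.map_apply hX (measurableSet_le (measurable_Mharm K) measurable_const)]
        rfl
  rw [VAD, key]
  have hpi : IsUnifCoupling (Measure.pi fun _ : Fin K => unif01) :=
    ⟨inferInstance, fun i => (measurePreserving_eval _ i).map_eq⟩
  have hsub : {y | ∃ ν : Measure (Fin K → ℝ), IsUnifCoupling ν ∧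
      y = lQuantile ν (Mharm K) ε} ⊆ feasibleLevels K ε := by
    rintro _ ⟨ν, hν, rfl⟩
    have := hν.isProbabilityMeasure
    exact ⟨ν, hν, le_measureReal_le_lQuantile (measurable_Mharm K)
      (hν.nonempty_quantile hK hε1)⟩
  have hbdd : BddBelow (feasibleLevels K ε) :=
    ⟨0, fun x ⟨ν, hν, hx⟩ => (hν.pos_of_le hK hε hx).le⟩
  apply le_antisymm
  · refine le_csInf ⟨_, hsub ⟨_, hpi, rfl⟩⟩ fun x ⟨ν, hν, hx⟩ => ?_
    exact (csInf_le (hbdd.mono hsub) ⟨ν, hν, rfl⟩).trans (hν.lQuantile_le hK hε hx)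
  · exact csInf_le_csInf hbdd ⟨_, _, hpi, rfl⟩ hsub

lemma unif01_eq_restrict_Ioc : unif01 = volume.restrict (Ioc (0:ℝ) 1) :=
  (restrict_Ioc_eq_restrict_Icc).symm

/-- The law of `a U + b` with `U` uniform on `[0,1]`. -/
lemma map_affine_unif01 {a : ℝ} (ha : 0 < a) (b : ℝ) :
    unif01.map (fun u => a * u + b) =
      ENNReal.ofReal a⁻¹ • volume.restrict (Ioc b (a + b)) := by
  have hm : Measurable fun u : ℝ => a * u + b := by fun_prop
  have hpre : (Ioc (0:ℝ) 1) = (fun u => a * u + b) ⁻¹' Ioc b (a + b) := by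
    ext u
    simp only [mem_Ioc, mem_preimage]
    constructor
    · rintro ⟨h0, h1⟩
      constructor <;> nlinarith
    · rintro ⟨h0, h1⟩
      constructor <;> by_contra h <;> nlinarith
  have hvol : (volume : Measure ℝ).map (fun u => a * u + b) = ENNReal.ofReal a⁻¹ • volume := by
    have : (fun u : ℝ => a * u + b) = (fun u => u + b) ∘ (fun u => a * u) := rfl
    rw [this, ← Measure.map_map (by fun_prop) (by fun_prop), Real.map_volume_mul_left ha.ne',
      Measure.map_smul, map_add_right_eq_self, abs_of_pos (inv_pos.2 ha)]
  rw [unif01_eq_restrict_Ioc, hpre, ← Measure.restrict_map hm measurableSet_Ioc, hvol,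
    Measure.restrict_smul]

lemma ofReal_smul_map_affine_unif01 {a : ℝ} (ha : 0 < a) (b : ℝ) :
    ENNReal.ofReal a • unif01.map (fun u => a * u + b) = volume.restrict (Ioc b (a + b)) := by
  rw [map_affine_unif01 ha, smul_smul, ← ENNReal.ofReal_mul ha.le, mul_inv_cancel₀ ha.ne']
  simp

lemma mul_mem_feasibleLevels {K : ℕ} (hK : 0 < K) {ε x : ℝ} (hε : ε ∈ Ioo (0:ℝ) 1)
    (hx : x ∈ feasibleLevels K 1) : ε * x ∈ feasibleLevels K ε := by
  obtain ⟨ν, hν, hνx⟩ := hx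
  have := hν.isProbabilityMeasure
  have h1 : ν {v | Mharm K v ≤ x} = 1 := by
    apply le_antisymm prob_le_one
    rw [← ENNReal.ofReal_one]
    exact ENNReal.ofReal_le_of_le_toReal hνx
  have hε' : 0 < 1 - ε := sub_pos.2 hε.2
  let T₁ : (Fin K → ℝ) → (Fin K → ℝ) := fun v => ε • v
  let T₂ : (Fin K → ℝ) → (Fin K → ℝ) := fun v i => (1 - ε) * v i + ε
  have hT₁ : Measurable T₁ := by fun_prop
  have hT₂ : Measurable T₂ := by fun_prop
  let ρ : Measure (Fin K → ℝ) :=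
    ENNReal.ofReal ε • ν.map T₁ + ENNReal.ofReal (1 - ε) • ν.map T₂
  have hmarg : ∀ i, ρ.map (fun v => v i) = unif01 := by
    intro i
    have e1 : ν.map (fun v => T₁ v i) = unif01.map (fun u => ε * u + 0) := by
      rw [← hν.map_eval i, Measure.map_map (by fun_prop) (by fun_prop)]
      congr 1
      ext v
      simp [T₁]
    have e2 : ν.map (fun v => T₂ v i) = unif01.map (fun u => (1 - ε) * u + ε) := by
      rw [← hν.map_eval i, Measure.map_map (by fun_prop) (by fun_prop)]
      rfl
    simp only [ρ]
    rw [Measure.map_add _ _ (by fun_prop), Measure.map_smul, Measure.map_smul,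
      Measure.map_map (by fun_prop) hT₁, Measure.map_map (by fun_prop) hT₂]
    simp only [Function.comp_def]
    rw [e1, e2, ofReal_smul_map_affine_unif01 hε.1, ofReal_smul_map_affine_unif01 hε',
      ← Measure.restrict_union (by simp) measurableSet_Ioc, unif01_eq_restrict_Ioc]
    simp [Ioc_union_Ioc_eq_Ioc hε.1.le hε.2.le]
  have hρ : IsProbabilityMeasure ρ := by
    have : IsProbabilityMeasure (ρ.map fun v => v ⟨0, hK⟩) := by
      rw [hmarg]; infer_instance
    exact Measure.isProbabilityMeasure_of_map (μ := ρ) fun v => v ⟨0, hK⟩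
  refine ⟨ρ, ⟨hρ, hmarg⟩, ?_⟩
  rw [← ENNReal.ofReal_le_iff_le_toReal (measure_ne_top _ _)]
  have hpre : T₁ ⁻¹' {v | Mharm K v ≤ ε * x} = {v | Mharm K v ≤ x} := by
    ext v
    simp [T₁, Mharm_smul, hε.1]
  calc ENNReal.ofReal ε = ENNReal.ofReal ε * ν.map T₁ {v | Mharm K v ≤ ε * x} := by
        rw [Measure.map_apply hT₁ (measurableSet_le (measurable_Mharm K) measurable_const),
          hpre, h1, mul_one]
    _ ≤ ρ {v | Mharm K v ≤ ε * x} := by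
        simp [ρ]

lemma div_mem_feasibleLevels {K : ℕ} (hK : 0 < K) {ε x : ℝ} (hε : 0 < ε)
    (hx : x ∈ feasibleLevels K ε) : x / ε ∈ feasibleLevels K 1 := by
  obtain ⟨ν, hν, hνx⟩ := hx
  have := hν.isProbabilityMeasure
  let A : Set (Fin K → ℝ) := {v | Mharm K v ≤ x}
  have hA : MeasurableSet A := measurableSet_le (measurable_Mharm K) measurable_const
  have hεA : ENNReal.ofReal ε ≤ ν A := ENNReal.ofReal_le_of_le_toReal hνx
  have hA0 : ν A ≠ 0 := (lt_of_lt_of_le (ENNReal.ofReal_pos.2 hε) hεA).ne'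
  have hμ : IsProbabilityMeasure (ν[|A]) := cond_isProbabilityMeasure hA0
  have hμle : ∀ s, ν[|A] s ≤ (ENNReal.ofReal ε)⁻¹ * ν s := by
    intro s
    rw [cond_apply hA]
    gcongr
    exact inter_subset_right
  let μ : Fin K → Measure ℝ := fun i => (ν[|A]).map fun v => v i
  have hμp : ∀ i, IsProbabilityMeasure (μ i) := fun i =>
    Measure.isProbabilityMeasure_map (measurable_pi_apply i).aemeasurable
  have hμi : ∀ i s, MeasurableSet s → μ i s ≤ (ENNReal.ofReal ε)⁻¹ * unif01 s := by
    intro i s hs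
    simp only [μ]
    rw [Measure.map_apply (measurable_pi_apply i) hs, ← hν.measure_preimage_eval i hs]
    exact hμle _
  have hna : ∀ i, NullSingletonClass (μ i) := fun i => ⟨fun t => by
    simpa using hμi i {t} (measurableSet_singleton t)⟩
  have hcm : ∀ i, Measurable (cdf (μ i)) := fun i => (continuous_cdf (μ i)).measurable
  let T : (Fin K → ℝ) → (Fin K → ℝ) := fun v i => cdf (μ i) (v i)
  have hT : Measurable T :=
    measurable_pi_lambda _ fun i => (hcm i).comp (measurable_pi_apply i)
  have hcoup : IsUnifCoupling ((ν[|A]).map T) := by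
    refine ⟨Measure.isProbabilityMeasure_map hT.aemeasurable, fun i => ?_⟩
    rw [← map_cdf (μ i), Measure.map_map (measurable_pi_apply i) hT,
      Measure.map_map (hcm i) (measurable_pi_apply i)]
    rfl
  refine ⟨_, hcoup, ?_⟩
  have hcdf : ∀ i t, 0 ≤ t → cdf (μ i) t ≤ ε⁻¹ * t := by
    intro i t ht
    rw [cdf_eq_real]
    refine ENNReal.toReal_le_of_le_ofReal (by positivity) ?_
    refine (hμi i _ measurableSet_Iic).trans ?_
    rw [unif01_Iic, ENNReal.ofReal_mul (by positivity), ENNReal.ofReal_inv_of_pos hε]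
    gcongr
    exact min_le_right _ _
  have hae : ∀ᵐ v ∂(ν[|A]), Mharm K (T v) ≤ x / ε := by
    have h1 : ∀ᵐ v ∂(ν[|A]), v ∈ A := ae_cond_mem hA
    have h2 : ∀ᵐ v ∂(ν[|A]), ∀ i, v i ∈ Ioc (0:ℝ) 1 :=
      cond_absolutelyContinuous.ae_le hν.ae_mem_Ioc
    have h3 : ∀ᵐ v ∂(ν[|A]), ∀ i, T v i ∈ Ioc (0:ℝ) 1 :=
      ae_of_ae_map hT.aemeasurable hcoup.ae_mem_Ioc
    filter_upwards [h1, h2, h3] with v hv1 hv2 hv3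
    calc Mharm K (T v) ≤ Mharm K (ε⁻¹ • v) :=
          Mharm_mono hK (fun i => (hv3 i).1) fun i => hcdf i _ (hv2 i).1.le
      _ = ε⁻¹ * Mharm K v := Mharm_smul _ _ _
      _ ≤ ε⁻¹ * x := by gcongr; exact hv1
      _ = x / ε := by rw [div_eq_inv_mul]
  have hms : MeasurableSet {v | Mharm K v ≤ x / ε} :=
    measurableSet_le (measurable_Mharm K) measurable_const
  have : (ν[|A]).map T {v | Mharm K v ≤ x / ε} = 1 := by
    rw [Measure.map_apply hT hms]
    exact (prob_compl_eq_zero_iff (hT hms)).1 hae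
  rw [this]
  simp

open scoped Pointwise in
lemma sInf_feasibleLevels {K : ℕ} (hK : 0 < K) {ε : ℝ} (hε : ε ∈ Ioo (0:ℝ) 1) :
    sInf (feasibleLevels K ε) = ε * sInf (feasibleLevels K 1) := by
  have : feasibleLevels K ε = ε • feasibleLevels K 1 := by
    ext x
    rw [mem_smul_set]
    constructor
    · intro hx
      exact ⟨x / ε, div_mem_feasibleLevels hK hε.1 hx, mul_div_cancel₀ x hε.1.ne'⟩
    · rintro ⟨y, hy, rfl⟩
      exact mul_mem_feasibleLevels hK hε hy
  rw [this, Real.sInf_smul_of_nonneg hε.1.le, smul_eq_mul]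

lemma sum_restrict_Ioc (K n : ℕ) :
    ∑ m ∈ Finset.range n, (volume : Measure ℝ).restrict (Ioc ((m : ℝ) / K) ((K : ℝ)⁻¹ + m / K)) =
      volume.restrict (Ioc 0 ((n : ℝ) / K)) := by
  induction n with
  | zero => simp
  | succ n ih =>
    have e : (K : ℝ)⁻¹ + n / K = ((n + 1 : ℕ) : ℝ) / K := by
      push_cast
      rw [add_div, add_comm, one_div]
    rw [Finset.sum_range_succ, ih, e, ← Measure.restrict_union (by simp) measurableSet_Ioc,
      Ioc_union_Ioc_eq_Ioc (by positivity) (by gcongr; omega)]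

lemma harmonic_inv_mem_feasibleLevels {K : ℕ} (hK : 0 < K) :
    ((harmonic K : ℚ) : ℝ)⁻¹ ∈ feasibleLevels K 1 := by
  have : NeZero K := ⟨hK.ne'⟩
  have hK' : (0:ℝ) < K := by exact_mod_cast hK
  let T : Fin K → ℝ → (Fin K → ℝ) := fun j w i => (K : ℝ)⁻¹ * w + ((i + j : Fin K) : ℕ) / K
  have hT : ∀ j, Measurable (T j) := fun j => by fun_prop
  let ρ : Measure (Fin K → ℝ) := ∑ j, ENNReal.ofReal (K : ℝ)⁻¹ • unif01.map (T j)
  have hmarg : ∀ i, ρ.map (fun v => v i) = unif01 := by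
    intro i
    have h1 : ρ.map (fun v => v i) =
        ∑ j, ENNReal.ofReal (K : ℝ)⁻¹ •
          unif01.map (fun w => (K : ℝ)⁻¹ * w + ((i + j : Fin K) : ℕ) / K) := by
      ext s hs
      rw [Measure.map_apply (measurable_pi_apply i) hs]
      simp only [ρ, Measure.coe_finsetSum, Finset.sum_apply, Measure.smul_apply]
      refine Finset.sum_congr rfl fun j _ => ?_
      rw [Measure.map_apply (hT j) (measurable_pi_apply i hs),
        Measure.map_apply (by fun_prop) hs]
      rfl
    rw [h1]
    simp_rw [ofReal_smul_map_affine_unif01 (inv_pos.2 hK')]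
    refine (Equiv.sum_comp (Equiv.addLeft i) fun m : Fin K =>
      (volume : Measure ℝ).restrict (Ioc (((m : ℕ) : ℝ) / K) ((K : ℝ)⁻¹ + (m : ℕ) / K))).trans ?_
    rw [Fin.sum_univ_eq_sum_range (fun m : ℕ =>
        (volume : Measure ℝ).restrict (Ioc ((m : ℝ) / K) ((K : ℝ)⁻¹ + m / K))) K,
      sum_restrict_Ioc, div_self hK'.ne', unif01_eq_restrict_Ioc]
  have hρ : IsProbabilityMeasure ρ := by
    have : IsProbabilityMeasure (ρ.map fun v => v ⟨0, hK⟩) := by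
      rw [hmarg]; infer_instance
    exact Measure.isProbabilityMeasure_of_map (μ := ρ) fun v => v ⟨0, hK⟩
  refine ⟨ρ, ⟨hρ, hmarg⟩, ?_⟩
  have hH : (0:ℝ) < (harmonic K : ℚ) := by exact_mod_cast harmonic_pos hK.ne'
  have hbound : ∀ j, ∀ w ∈ Ioc (0:ℝ) 1, Mharm K (T j w) ≤ ((harmonic K : ℚ) : ℝ)⁻¹ := by
    intro j w hw
    have hsum : (K : ℝ) * (harmonic K : ℚ) ≤ ∑ i, (T j w i)⁻¹ := by
      simp only [T]
      refine le_of_le_of_eq ?_ (Equiv.sum_comp (Equiv.addRight j) fun m : Fin K =>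
        ((K : ℝ)⁻¹ * w + ((m : ℕ) : ℝ) / K)⁻¹).symm
      rw [Fin.sum_univ_eq_sum_range (fun m : ℕ => ((K : ℝ)⁻¹ * w + (m : ℝ) / K)⁻¹) K, harmonic]
      push_cast
      rw [Finset.mul_sum]
      refine Finset.sum_le_sum fun m _ => ?_
      have h0 : (0:ℝ) ≤ m := by positivity
      have h1 := hw.1
      have e : (K : ℝ)⁻¹ * w + (m : ℝ) / K = (w + m) / K := by field_simp
      rw [e, inv_div, div_eq_mul_inv]
      gcongr ?_ * ?_
      rw [add_comm w]
      exact inv_anti₀ (by positivity) (by linarith [hw.2])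
    calc Mharm K (T j w) ≤ K / ((K : ℝ) * (harmonic K : ℚ)) := by
          unfold Mharm
          gcongr
      _ = ((harmonic K : ℚ) : ℝ)⁻¹ := by field_simp
  have hms : MeasurableSet {v | Mharm K v ≤ ((harmonic K : ℚ) : ℝ)⁻¹} :=
    measurableSet_le (measurable_Mharm K) measurable_const
  have hone : ∀ j, unif01.map (T j) {v | Mharm K v ≤ ((harmonic K : ℚ) : ℝ)⁻¹} = 1 := by
    intro j
    rw [Measure.map_apply (hT j) hms]
    refine (prob_compl_eq_zero_iff (hT j hms)).1 ?_
    filter_upwards [ae_unif01_mem_Ioc] with w hw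
    exact hbound j w hw
  simp only [ρ, Measure.coe_finsetSum, Finset.sum_apply, Measure.smul_apply, hone]
  simp [ENNReal.ofReal_inv_of_pos hK', hK.ne']

lemma integral_indicator_inv_unif01 {c : ℝ} (hc : c ∈ Ioc (0:ℝ) 1) :
    ∫ u, (Ici c).indicator (fun u => u⁻¹) u ∂unif01 = Real.log c⁻¹ := by
  rw [integral_indicator measurableSet_Ici, unif01, Measure.restrict_restrict measurableSet_Ici]
  have : Ici c ∩ Icc 0 1 = Icc c 1 := by
    ext u
    simp only [mem_inter_iff, mem_Ici, mem_Icc]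
    exact ⟨fun h => ⟨h.1, h.2.2⟩, fun h => ⟨h.1, hc.1.le.trans h.1, h.2⟩⟩
  rw [this, integral_Icc_eq_integral_Ioc, ← intervalIntegral.integral_of_le hc.2,
    integral_inv_of_pos hc.1 one_pos, one_div]

lemma integrable_indicator_inv {c : ℝ} (hc : 0 < c) {μ : Measure ℝ} [IsFiniteMeasure μ] :
    Integrable ((Ici c).indicator fun u => u⁻¹) μ := by
  refine Integrable.of_bound
    ((measurable_inv.indicator measurableSet_Ici).aestronglyMeasurable) c⁻¹
    (Eventually.of_forall fun u => ?_)
  rw [indicator_apply]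
  split_ifs with h
  · have hu : 0 < u := hc.trans_le h
    rw [Real.norm_of_nonneg (inv_nonneg.2 hu.le)]
    exact inv_anti₀ hc h
  · simpa using hc.le

/-- Truncation bound: no coupling of uniforms can have harmonic mean below
`(1 - t) / log (K / t)` almost surely. -/
lemma one_sub_le_mul_log_of_mem_feasibleLevels {K : ℕ} (hK : 0 < K) {x t : ℝ}
    (hx : x ∈ feasibleLevels K 1) (ht : t ∈ Ioo (0:ℝ) 1) : 1 - t ≤ x * Real.log (K / t) := by
  obtain ⟨ν, hν, hνx⟩ := hx
  have := hν.isProbabilityMeasure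
  have hx0 : 0 < x := hν.pos_of_le hK one_pos hνx
  have hK' : (0:ℝ) < K := by exact_mod_cast hK
  have hK1 : (1:ℝ) ≤ K := by exact_mod_cast hK
  let c : ℝ := t / K
  have hc0 : 0 < c := div_pos ht.1 hK'
  have hc1 : c ≤ 1 := (div_le_one hK').2 (ht.2.le.trans hK1)
  let A : Set (Fin K → ℝ) := {v | ∀ i, c ≤ v i}
  have hAm : MeasurableSet A := by
    have : A = ⋂ i, {v | c ≤ v i} := by ext; simp [A]
    rw [this]
    exact MeasurableSet.iInter fun i => measurableSet_le measurable_const (measurable_pi_apply i)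
  have hAc : ν.real Aᶜ ≤ t := by
    have hsub : Aᶜ ⊆ ⋃ i ∈ (Finset.univ : Finset (Fin K)), {v | v i ∈ Iic c} := by
      intro v hv
      simp only [A, mem_compl_iff, mem_ofPred_eq, not_forall, not_le] at hv
      obtain ⟨i, hi⟩ := hv
      simp only [mem_iUnion]
      exact ⟨i, Finset.mem_univ _, hi.le⟩
    calc ν.real Aᶜ ≤ ν.real (⋃ i ∈ (Finset.univ : Finset (Fin K)), {v | v i ∈ Iic c}) :=
          measureReal_mono hsub (measure_ne_top _ _)
      _ ≤ ∑ i : Fin K, ν.real {v | v i ∈ Iic c} := measureReal_biUnion_finset_le _ _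
      _ = ∑ i : Fin K, c := by
          refine Finset.sum_congr rfl fun i _ => ?_
          rw [Measure.real, hν.measure_preimage_eval i measurableSet_Iic, unif01_Iic,
            min_eq_right hc1, ENNReal.toReal_ofReal hc0.le]
      _ = t := by simp [c]; field_simp
  have hA : 1 - t ≤ ν.real A := by
    have := probReal_add_probReal_compl (μ := ν) hAm
    linarith
  have hle : ∀ᵐ v ∂ν, A.indicator (fun _ => (K : ℝ) / x) v ≤
      ∑ i, (Ici c).indicator (fun u => u⁻¹) (v i) := by
    have h1 : ∀ᵐ v ∂ν, Mharm K v ≤ x := by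
      refine (prob_compl_eq_zero_iff
        (measurableSet_le (measurable_Mharm K) measurable_const)).2 ?_
      apply le_antisymm prob_le_one
      rw [← ENNReal.ofReal_one]
      exact ENNReal.ofReal_le_of_le_toReal hνx
    filter_upwards [h1, hν.ae_mem_Ioc] with v hv hv0
    by_cases hvA : v ∈ A
    · rw [indicator_of_mem hvA]
      have : ∀ i, (Ici c).indicator (fun u => u⁻¹) (v i) = (v i)⁻¹ := fun i =>
        indicator_of_mem (hvA i) _
      simp only [this]
      have hs := sum_inv_pos hK fun i => (hv0 i).1
      rw [Mharm, div_le_iff₀ hs] at hv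
      rw [div_le_iff₀ hx0]
      linarith
    · rw [indicator_of_notMem hvA]
      refine Finset.sum_nonneg fun i _ => indicator_nonneg (fun u hu => ?_) _
      exact inv_nonneg.2 (hc0.le.trans hu)
  have hint : ∀ i : Fin K, Integrable (fun v : Fin K → ℝ =>
      (Ici c).indicator (fun u => u⁻¹) (v i)) ν := fun i => by
    refine Integrable.comp_measurable (g := (Ici c).indicator fun u : ℝ => u⁻¹)
      (integrable_indicator_inv hc0) (measurable_pi_apply i)
  have hI := integral_mono_ae ((integrable_const ((K : ℝ) / x)).indicator hAm)
    (integrable_finsetSum _ fun i _ => hint i) hle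
  rw [integral_indicator_const _ hAm, integral_finsetSum _ fun i _ => hint i] at hI
  have hterm : ∀ i : Fin K, ∫ v, (Ici c).indicator (fun u => u⁻¹) (v i) ∂ν = Real.log (K / t) := by
    intro i
    have hmeas : Measurable ((Ici c).indicator fun u : ℝ => u⁻¹) :=
      measurable_inv.indicator measurableSet_Ici
    rw [← integral_map (μ := ν) (φ := fun v => v i) (measurable_pi_apply i).aemeasurable
      (hmeas.aestronglyMeasurable), hν.map_eval, integral_indicator_inv_unif01 ⟨hc0, hc1⟩]
    simp [c]
  simp only [hterm, Finset.sum_const, Finset.card_univ, Fintype.card_fin, nsmul_eq_mul,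
    smul_eq_mul] at hI
  have h2 : ν.real A ≤ x * Real.log (K / t) := by
    have e : ν.real A * (K / x) = K * (ν.real A / x) := by ring
    rw [e] at hI
    have := le_of_mul_le_mul_left hI hK'
    rw [div_le_iff₀ hx0] at this
    linarith
  exact hA.trans h2

/-- The worst-case constant `a_F(ε) / ε` of the harmonic mean. -/
noncomputable def harmonicConst (K : ℕ) : ℝ := sInf (feasibleLevels K 1)

lemma harmonicConst_le {K : ℕ} (hK : 0 < K) :
    harmonicConst K ≤ (Real.log (K + 1))⁻¹ := by
  have hbdd : BddBelow (feasibleLevels K 1) :=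
    ⟨0, fun x ⟨ν, hν, hx⟩ => (hν.pos_of_le hK one_pos hx).le⟩
  refine (csInf_le hbdd (harmonic_inv_mem_feasibleLevels hK)).trans ?_
  have hK' : (0:ℝ) < K := by exact_mod_cast hK
  refine inv_anti₀ (Real.log_pos (by linarith)) ?_
  exact_mod_cast log_add_one_le_harmonic K

lemma one_sub_le_harmonicConst_mul_log {K : ℕ} (hK : 0 < K) {t : ℝ} (ht : t ∈ Ioo (0:ℝ) 1) :
    1 - t ≤ harmonicConst K * Real.log (K / t) := by
  have hK1 : (1:ℝ) ≤ K := by exact_mod_cast hK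
  have hlog : 0 < Real.log (K / t) :=
    Real.log_pos ((one_lt_div ht.1).2 (ht.2.trans_le hK1))
  rw [← div_le_iff₀ hlog]
  refine le_csInf ⟨_, harmonic_inv_mem_feasibleLevels hK⟩ fun x hx => ?_
  rw [div_le_iff₀ hlog]
  exact one_sub_le_mul_log_of_mem_feasibleLevels hK hx ht

lemma harmonicConst_pos {K : ℕ} (hK : 0 < K) : 0 < harmonicConst K := by
  have h := one_sub_le_harmonicConst_mul_log hK (t := 1 / 2) (by norm_num)
  have hK1 : (1:ℝ) ≤ K := by exact_mod_cast hK
  have hlog : 0 < Real.log (K / (1 / 2)) := Real.log_pos (by linarith)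
  by_contra hneg
  nlinarith

lemma tendsto_inv_harmonicConst_div_log :
    Tendsto (fun K : ℕ => (harmonicConst K)⁻¹ / Real.log K) atTop (nhds 1) := by
  have hlog : Tendsto (fun K : ℕ => Real.log K) atTop atTop :=
    Real.tendsto_log_atTop.comp tendsto_natCast_atTop_atTop
  have hupper : Tendsto (fun K : ℕ => (1 + Real.log (Real.log K) / Real.log K) /
      (1 - (Real.log K)⁻¹)) atTop (nhds 1) := by
    have h1 : Tendsto (fun y : ℝ => Real.log y / y) atTop (nhds 0) :=
      Real.isLittleO_log_id_atTop.tendsto_div_nhds_zero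
    have h2 := (h1.comp hlog).const_add 1
    have h3 := (tendsto_inv_atTop_zero.comp hlog).const_sub 1
    have := h2.div h3 (by norm_num)
    simpa [Function.comp_def, Pi.div_def] using this
  refine tendsto_of_tendsto_of_tendsto_of_le_of_le' tendsto_const_nhds hupper ?_ ?_
  · filter_upwards [eventually_ge_atTop 2] with K hK
    have hK0 : 0 < K := by omega
    have hK2 : (2:ℝ) ≤ K := by exact_mod_cast hK
    have hl : 0 < Real.log K := Real.log_pos (by linarith)
    rw [one_le_div hl, le_inv_comm₀ hl (harmonicConst_pos hK0)]
    refine (harmonicConst_le hK0).trans (inv_anti₀ hl ?_)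
    exact Real.log_le_log (by linarith) (by linarith)
  · filter_upwards [eventually_ge_atTop 2, hlog.eventually_gt_atTop 1] with K hK hl
    have hK0 : 0 < K := by omega
    have hK2 : (2:ℝ) ≤ K := by exact_mod_cast hK
    have hl0 : 0 < Real.log K := by linarith
    have hinv : (Real.log K)⁻¹ ∈ Ioo (0:ℝ) 1 := ⟨inv_pos.2 hl0, inv_lt_one_of_one_lt₀ hl⟩
    have h := one_sub_le_harmonicConst_mul_log hK0 hinv
    have hpos := harmonicConst_pos hK0
    rw [div_inv_eq_mul, Real.log_mul (by linarith) hl0.ne'] at h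
    have h1 : 0 < 1 - (Real.log K)⁻¹ := sub_pos.2 hinv.2
    rw [le_div_iff₀ h1, div_mul_eq_mul_div, div_le_iff₀ hl0, add_mul, one_mul,
      div_mul_cancel₀ _ hl0.ne', inv_mul_le_iff₀ hpos]
    exact h

lemma isUnifCoupling_pi (K : ℕ) : IsUnifCoupling (Measure.pi fun _ : Fin K => unif01) :=
  ⟨inferInstance, fun i => (measurePreserving_eval _ i).map_eq⟩

lemma unif01_real_Iic_le {a : ℝ} (ha : 0 ≤ a) : unif01.real (Iic a) ≤ a := by
  rw [Measure.real, unif01_Iic]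
  exact ENNReal.toReal_le_of_le_ofReal ha (ENNReal.ofReal_le_ofReal (min_le_right _ _))

lemma unif01_Ioi {a : ℝ} (ha : a ∈ Icc (0:ℝ) 1) : unif01 (Ioi a) = ENNReal.ofReal (1 - a) := by
  rw [← compl_Iic, prob_compl_eq_one_sub measurableSet_Iic, unif01_Iic, min_eq_right ha.2,
    ENNReal.ofReal_sub _ ha.1, ENNReal.ofReal_one]

/-- The harmonic mean is small as soon as one argument is. -/
lemma Mharm_le_of_le {K : ℕ} {p : Fin K → ℝ} (hp : ∀ i, 0 < p i) {x : ℝ} (i : Fin K)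
    (hi : p i ≤ x / K) : Mharm K p ≤ x := by
  have hK : 0 < K := i.pos
  have hK' : (0:ℝ) < K := by exact_mod_cast hK
  have hx : 0 < x := by
    have := (hp i).trans_le hi
    exact (div_pos_iff_of_pos_right hK').1 this
  have h1 : (K : ℝ) / x ≤ ∑ j, (p j)⁻¹ := by
    calc (K : ℝ) / x = (x / K)⁻¹ := (inv_div _ _).symm
      _ ≤ (p i)⁻¹ := inv_anti₀ (hp i) hi
      _ ≤ ∑ j, (p j)⁻¹ := Finset.single_le_sum (f := fun j => (p j)⁻¹)
          (fun j _ => (inv_pos.2 (hp j)).le) (Finset.mem_univ i)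
  rw [div_le_iff₀ hx] at h1
  rw [Mharm, div_le_iff₀ (sum_inv_pos hK hp)]
  linarith

/-- A small harmonic mean forces one very small argument or two fairly small ones. -/
lemma exists_small_of_Mharm_le {K : ℕ} (hK : 0 < K) {p : Fin K → ℝ} (hp : ∀ i, 0 < p i)
    {x η : ℝ} (hx : 0 < x) (hη : η ∈ Ioo (0:ℝ) 1) (h : Mharm K p ≤ x) :
    (∃ i, p i ≤ x / ((1 - η) * K)) ∨ ∃ i j, i ≠ j ∧ p i ≤ x / η ∧ p j ≤ x / η := by
  by_contra! hcon
  obtain ⟨h1, h2⟩ := hcon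
  have hK' : (0:ℝ) < K := by exact_mod_cast hK
  have hη0 := hη.1
  have hη1 : 0 < 1 - η := sub_pos.2 hη.2
  rw [Mharm, div_le_iff₀ (sum_inv_pos hK hp)] at h
  have hlt : ∑ i, (p i)⁻¹ < K / x := by
    have b1 : ∀ i, (p i)⁻¹ < (1 - η) * K / x := fun i => by
      rw [← inv_div]; exact inv_strictAnti₀ (by positivity) (h1 i)
    have b2 : ∀ i, x / η < p i → (p i)⁻¹ < η / x := fun i hi => by
      rw [← inv_div]; exact inv_strictAnti₀ (by positivity) hi
    by_cases hex : ∃ i, p i ≤ x / η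
    · obtain ⟨i₀, hi₀⟩ := hex
      calc ∑ i, (p i)⁻¹ < ∑ i, (η / x + if i = i₀ then (1 - η) * K / x else 0) := by
            have hpos : 0 < η / x := by positivity
            refine Finset.sum_lt_sum (fun j _ => ?_) ⟨i₀, Finset.mem_univ _, ?_⟩
            · split_ifs with hj
              · linarith [b1 j]
              · simpa using (b2 j (h2 i₀ j (Ne.symm hj) hi₀)).le
            · rw [if_pos rfl]; linarith [b1 i₀]
        _ = K / x := by
            simp only [Finset.sum_add_distrib, Finset.sum_const, Finset.card_univ,
              Fintype.card_fin, nsmul_eq_mul, Finset.sum_ite_eq', Finset.mem_univ, if_true]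
            ring
    · push Not at hex
      calc ∑ i, (p i)⁻¹ < ∑ i : Fin K, η / x :=
            Finset.sum_lt_sum_of_nonempty ⟨⟨0, hK⟩, Finset.mem_univ _⟩ fun i _ => b2 i (hex i)
        _ = K * η / x := by simp; ring
        _ ≤ K / x := by gcongr; nlinarith [hη.2]
  rw [lt_div_iff₀ hx] at hlt
  linarith

lemma VI_Mharm_le {K : ℕ} (hK : 0 < K) {δ : ℝ} (hδ : δ ∈ Ioo (0:ℝ) (1 / 2)) :
    VI K (Mharm K) δ ≤ δ / (1 - δ) := by
  have hK' : (0:ℝ) < K := by exact_mod_cast hK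
  have hK1 : (1:ℝ) ≤ K := by exact_mod_cast hK
  have hδ1 : 0 < 1 - δ := by linarith [hδ.2]
  set x := δ / (1 - δ) with hxdef
  have hx0 : 0 < x := div_pos hδ.1 hδ1
  have hx1 : x ≤ 1 := by rw [hxdef, div_le_one hδ1]; linarith [hδ.2]
  have hxK : x / K ≤ 1 := (div_le_one hK').2 (hx1.trans hK1)
  refine (isUnifCoupling_pi K).lQuantile_le hK hδ.1 ?_
  set ρ := Measure.pi fun _ : Fin K => unif01
  have hms : MeasurableSet {v | Mharm K v ≤ x} :=
    measurableSet_le (measurable_Mharm K) measurable_const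
  have hcompl : ρ.real {v | Mharm K v ≤ x}ᶜ ≤ (1 - x / K) ^ K := by
    refine ENNReal.toReal_le_of_le_ofReal (pow_nonneg (by linarith) _) ?_
    calc ρ {v | Mharm K v ≤ x}ᶜ ≤ ρ (univ.pi fun _ => Ioi (x / K)) := by
          refine measure_mono_ae ?_
          filter_upwards [(isUnifCoupling_pi K).ae_mem_Ioc] with v hv hvx i _
          by_contra hi
          exact hvx (Mharm_le_of_le (fun i => (hv i).1) i (not_lt.1 hi))
      _ = ENNReal.ofReal ((1 - x / K) ^ K) := by
          rw [Measure.pi_pi, Finset.prod_const, unif01_Ioi ⟨by positivity, hxK⟩,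
            ENNReal.ofReal_pow (by linarith)]
          simp
  have hexp : (1 - x / K) ^ K ≤ 1 - δ := by
    calc (1 - x / K) ^ K ≤ Real.exp (-x) :=
          Real.one_sub_div_pow_le_exp_neg (hx1.trans hK1)
      _ ≤ (1 + x)⁻¹ := by
          rw [Real.exp_neg]
          exact inv_anti₀ (by linarith) (by linarith [Real.add_one_le_exp x])
      _ = 1 - δ := by rw [hxdef]; field_simp; ring
  have := probReal_add_probReal_compl (μ := ρ) hms
  change δ ≤ ρ.real _
  linarith

lemma measureReal_pi_Mharm_le {K : ℕ} (hK : 0 < K) {x η : ℝ} (hx : 0 < x)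
    (hη : η ∈ Ioo (0:ℝ) 1) :
    (Measure.pi fun _ : Fin K => unif01).real {v | Mharm K v ≤ x} ≤
      x / (1 - η) + K ^ 2 * (x / η) ^ 2 := by
  have hK' : (0:ℝ) < K := by exact_mod_cast hK
  have hη0 := hη.1
  have hη1 : 0 < 1 - η := sub_pos.2 hη.2
  set ρ := Measure.pi fun _ : Fin K => unif01
  let a : ℝ := x / ((1 - η) * K)
  let b : ℝ := x / η
  have ha : 0 ≤ a := by positivity
  have hb : 0 ≤ b := by positivity
  let A : Fin K → Set (Fin K → ℝ) := fun i => {v | v i ∈ Iic a}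
  let B : Fin K × Fin K → Set (Fin K → ℝ) := fun q =>
    if q.1 = q.2 then ∅ else {v | v q.1 ∈ Iic b} ∩ {v | v q.2 ∈ Iic b}
  have hA : ∀ i, ρ.real (A i) ≤ a := fun i => by
    rw [Measure.real, (isUnifCoupling_pi K).measure_preimage_eval i measurableSet_Iic]
    exact unif01_real_Iic_le ha
  have hB : ∀ q, ρ.real (B q) ≤ b ^ 2 := by
    rintro ⟨i, j⟩
    simp only [B]
    split_ifs with hij
    · simp; positivity
    · have hind : IndepFun (fun v : Fin K → ℝ => v i) (fun v => v j) ρ :=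
        (iIndepFun_pi (μ := fun _ : Fin K => unif01) (X := fun _ => id)
          (fun _ => aemeasurable_id)).indepFun hij
      have := hind.measure_inter_preimage_eq_mul _ _ (measurableSet_Iic (a := b))
        (measurableSet_Iic (a := b))
      rw [Measure.real]
      change (ρ ((fun v : Fin K → ℝ => v i) ⁻¹' Iic b ∩ (fun v => v j) ⁻¹' Iic b)).toReal ≤ _
      rw [this, ENNReal.toReal_mul, sq]
      have e : ∀ k : Fin K, (ρ ((fun v : Fin K → ℝ => v k) ⁻¹' Iic b)).toReal ≤ b := fun k => by
        have := (isUnifCoupling_pi K).measure_preimage_eval k (measurableSet_Iic (a := b))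
        change (ρ {v | v k ∈ Iic b}).toReal ≤ b
        rw [this]
        exact unif01_real_Iic_le hb
      exact mul_le_mul (e i) (e j) ENNReal.toReal_nonneg hb
  calc ρ.real {v | Mharm K v ≤ x}
      ≤ ρ.real ((⋃ i ∈ (Finset.univ : Finset (Fin K)), A i) ∪
          ⋃ q ∈ (Finset.univ : Finset (Fin K × Fin K)), B q) := by
        refine ENNReal.toReal_mono (measure_ne_top _ _) (measure_mono_ae ?_)
        filter_upwards [(isUnifCoupling_pi K).ae_mem_Ioc] with v hv hvx
        rcases exists_small_of_Mharm_le hK (fun i => (hv i).1) hx hη hvx with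
          ⟨i, hi⟩ | ⟨i, j, hij, hi, hj⟩
        · exact Or.inl (mem_biUnion (Finset.mem_univ i) hi)
        · refine Or.inr (mem_biUnion (Finset.mem_univ (i, j)) ?_)
          simp only [B, if_neg hij]
          exact ⟨hi, hj⟩
    _ ≤ ∑ i, ρ.real (A i) + ∑ q, ρ.real (B q) :=
        (measureReal_union_le _ _).trans
          (add_le_add (measureReal_biUnion_finset_le _ _) (measureReal_biUnion_finset_le _ _))
    _ ≤ ∑ _i : Fin K, a + ∑ _q : Fin K × Fin K, b ^ 2 :=
        add_le_add (Finset.sum_le_sum fun i _ => hA i) (Finset.sum_le_sum fun q _ => hB q)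
    _ = x / (1 - η) + K ^ 2 * (x / η) ^ 2 := by
        simp only [Finset.sum_const, Finset.card_univ, Fintype.card_fin, Fintype.card_prod,
          nsmul_eq_mul, a, b]
        push_cast
        field_simp

lemma le_VI_Mharm {K : ℕ} (hK : 0 < K) {δ η : ℝ} (hδ : δ ∈ Ioc (0:ℝ) 1) (hη : η ∈ Ioo (0:ℝ) 1)
    (hδη : K ^ 2 * δ ≤ η ^ 3) : (1 - η) ^ 2 * δ ≤ VI K (Mharm K) δ := by
  have hη0 := hη.1
  have hη1 : 0 < 1 - η := sub_pos.2 hη.2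
  have hδ0 := hδ.1
  have hK' : (0:ℝ) < K := by exact_mod_cast hK
  refine le_csInf ((isUnifCoupling_pi K).nonempty_quantile hK hδ.2) fun y hy => ?_
  have hy0 : 0 < y := (isUnifCoupling_pi K).pos_of_le hK hδ.1 hy
  by_contra! hlt
  have h1 : y / (1 - η) < (1 - η) * δ := by
    rw [div_lt_iff₀ hη1]
    linarith
  have hyδ : y ≤ δ := hlt.le.trans (mul_le_of_le_one_left hδ0.le (pow_le_one₀ hη1.le (by linarith)))
  have h2 : (K : ℝ) ^ 2 * (y / η) ^ 2 ≤ η * δ := by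
    calc (K : ℝ) ^ 2 * (y / η) ^ 2 ≤ (K : ℝ) ^ 2 * (δ / η) ^ 2 := by gcongr
      _ = (K ^ 2 * δ) * δ / η ^ 2 := by ring
      _ ≤ η ^ 3 * δ / η ^ 2 := by gcongr
      _ = η * δ := by field_simp
  have h3 := measureReal_pi_Mharm_le hK hy0 hη
  have h4 : δ ≤ (Measure.pi fun _ : Fin K => unif01).real {v | Mharm K v ≤ y} := hy
  linarith

lemma tendsto_VI_Mharm_div {K : ℕ} (hK : 0 < K) :
    Tendsto (fun δ => VI K (Mharm K) δ / δ) (nhdsWithin 0 (Ioi 0)) (nhds 1) := by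
  have hK' : (0:ℝ) < K := by exact_mod_cast hK
  rw [tendsto_order]
  constructor
  · intro c hc
    have hev : ∀ᶠ η in nhdsWithin (0:ℝ) (Ioi 0), c < (1 - η) ^ 2 := by
      have : Tendsto (fun η : ℝ => (1 - η) ^ 2) (nhdsWithin 0 (Ioi 0)) (nhds ((1 - 0) ^ 2)) :=
        ((continuous_const.sub continuous_id).pow 2).continuousAt.tendsto.mono_left
          nhdsWithin_le_nhds
      exact this.eventually_const_lt (by simpa using hc)
    obtain ⟨η, hηc, hη⟩ := (hev.and (Ioo_mem_nhdsGT one_pos)).exists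
    have hη0 := hη.1
    filter_upwards [Ioo_mem_nhdsGT (show (0:ℝ) < min 1 (η ^ 3 / K ^ 2) by positivity)] with δ hδ
    have hδ1 := hδ.2.trans_le (min_le_left _ _)
    have hδ2 := hδ.2.trans_le (min_le_right _ _)
    refine hηc.trans_le ?_
    rw [le_div_iff₀ hδ.1]
    refine le_VI_Mharm hK ⟨hδ.1, hδ1.le⟩ hη ?_
    rw [lt_div_iff₀ (by positivity)] at hδ2
    linarith
  · intro c hc
    have hev : ∀ᶠ δ in nhdsWithin (0:ℝ) (Ioi 0), (1 - δ)⁻¹ < c := by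
      have : Tendsto (fun δ : ℝ => (1 - δ)⁻¹) (nhdsWithin 0 (Ioi 0)) (nhds (1 - 0)⁻¹) :=
        ((continuousAt_const.sub continuousAt_id).inv₀ (by simp)).tendsto.mono_left
          nhdsWithin_le_nhds
      exact this.eventually_lt_const (by simpa using hc)
    filter_upwards [hev, Ioo_mem_nhdsGT (show (0:ℝ) < 1 / 2 by norm_num)] with δ hδc hδ
    refine lt_of_le_of_lt ?_ hδc
    rw [div_le_iff₀ hδ.1, ← div_eq_inv_mul]
    exact VI_Mharm_le hK hδ

lemma VC_Mharm {K : ℕ} (hK : 0 < K) {ε : ℝ} (hε : ε ∈ Ioo (0:ℝ) 1) : VC K (Mharm K) ε = ε := by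
  have : {x : ℝ | ε ≤ (unif01 {u | Mharm K (fun _ => u) ≤ x}).toReal} = Ici ε := by
    ext x
    simp only [Mharm_const hK]
    change ε ≤ (unif01 (Iic x)).toReal ↔ ε ≤ x
    rw [unif01_Iic, ← ENNReal.ofReal_le_iff_le_toReal ENNReal.ofReal_ne_top,
      ENNReal.ofReal_le_ofReal_iff', le_min_iff]
    constructor
    · rintro (h | h)
      · exact h.2
      · exact absurd h (not_le.2 hε.1)
    · exact fun h => Or.inl ⟨hε.2.le, h⟩
  rw [VC, lQuantile, this, csInf_Ici]

/-- for the harmonic averaging method, for each `K ≥ 3` the limit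
`L_K = lim_{δ↓0} b_F(δ)/a_F(δ)` exists, equals `c_F(ε)/a_F(ε)` for every `ε ∈ (0,1)`,
and `L_K / log K → 1` as `K → ∞`. -/
theorem harmonic_price_for_validity
    {Ω : Type*} [MeasurableSpace Ω] (P : MeasureTheory.Measure Ω)
    [MeasureTheory.IsProbabilityMeasure P] (hP : Atomless P) :
    ∃ L : ℕ → ℝ,
      (∀ K : ℕ, 3 ≤ K →
        Filter.Tendsto
          (fun δ : ℝ => VI K (Mharm K) δ / VAD P K (Mharm K) δ)
          (nhdsWithin 0 (Set.Ioi 0)) (nhds (L K)) ∧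
        (∀ ε ∈ Set.Ioo (0:ℝ) 1,
          VC K (Mharm K) ε / VAD P K (Mharm K) ε = L K)) ∧
      Filter.Tendsto (fun K : ℕ => L K / Real.log K) Filter.atTop (nhds 1) := by
  have hVAD : ∀ K : ℕ, 3 ≤ K → ∀ ε ∈ Ioo (0:ℝ) 1,
      VAD P K (Mharm K) ε = ε * harmonicConst K := fun K hK ε hε => by
    rw [VAD_eq_sInf_feasibleLevels hP (by omega) hε.1 hε.2.le,
      sInf_feasibleLevels (by omega) hε, harmonicConst]
  refine ⟨fun K => (harmonicConst K)⁻¹, fun K hK => ⟨?_, fun ε hε => ?_⟩,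
    tendsto_inv_harmonicConst_div_log⟩
  · have h := (tendsto_VI_Mharm_div (K := K) (by omega)).div_const (harmonicConst K)
    rw [one_div] at h
    refine h.congr' ?_
    filter_upwards [Ioo_mem_nhdsGT (one_pos (α := ℝ))] with δ hδ
    rw [hVAD K hK δ hδ, div_div]
  · rw [hVAD K hK ε hε, VC_Mharm (by omega) hε, div_mul_cancel_left₀ hε.1.ne']
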